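/- arXiv:2303.01942 — 2 statements merged into one kernel-verified Lean document; each statement's English description precedes it below -/
import Mathlib

section
/- Let A be a unital n-homogeneous C*-algebra (every irreducible representation has dimension n). Then for every a ∈ A, n^{-1/2} ‖a‖ ≤ ‖a‖_{2,T(A)} ≤ ‖a‖, where ‖a‖_{2,T(A)} = sup_{τ∈T(A)} τ(a*a)^{1/2}. In particular the C*-norm and the 2-norm ‖·‖_{2,T(A)} are equivalent on A. -/
/-- The set of tracial states on a unital C*-algebra, viewed inside the weak* dual. -/
def tracialStates (A : Type*) [NormedRing A] [StarRing A] [NormedAlgebra ℂ A] :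
    Set (WeakDual ℂ A) :=
  {φ | φ 1 = 1 ∧ (∀ a : A, 0 ≤ (φ (star a * a)).re ∧ (φ (star a * a)).im = 0) ∧
    ∀ a b : A, φ (a * b) = φ (b * a)}

/-- The 2-seminorm `‖a‖_{2,X} = sup_{τ ∈ X} τ(a*a)^{1/2}` associated to a set of traces. -/
noncomputable def norm2 {A : Type*} [NormedRing A] [StarRing A] [NormedAlgebra ℂ A]
    (X : Set (WeakDual ℂ A)) (a : A) : ℝ :=
  sSup ((fun φ : WeakDual ℂ A => Real.sqrt (φ (star a * a)).re) '' X)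

/-- A representation of `A` on a Hilbert space is irreducible if it is nondegenerate
(unital) and its commutant consists of the scalars. -/
def IsIrreducibleRep (A : Type) [NormedRing A] [StarRing A] [NormedAlgebra ℂ A]
    (H : Type) [NormedAddCommGroup H] [InnerProductSpace ℂ H] [CompleteSpace H]
    (π : A →⋆ₐ[ℂ] (H →L[ℂ] H)) : Prop :=
  Nontrivial H ∧ ∀ T : H →L[ℂ] H, (∀ a : A, T * π a = π a * T) →
    ∃ c : ℂ, T = c • (1 : H →L[ℂ] H)

open scoped ComplexOrder InnerProductSpace ComplexStarModule

namespace HomNorm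

section
variable {A : Type*} [CStarAlgebra A]

lemma im_zero (φ : A →L[ℂ] ℂ) (hφ : ‖φ‖ ≤ 1) (h1 : φ 1 = 1) (b : A) (hb : IsSelfAdjoint b) :
    (φ b).im = 0 := by
  have key : ∀ t : ℝ, ((φ b).im + t) ^ 2 ≤ ‖b‖ ^ 2 * ‖(1 : A)‖ + t ^ 2 * ‖(1 : A)‖ := by
    intro t
    have e1 : φ (b + (Complex.I * t) • (1 : A)) = φ b + Complex.I * t := by
      simp [h1]
    have e2 : star (b + (Complex.I * t) • (1 : A)) * (b + (Complex.I * t) • (1 : A))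
        = b * b + ((t : ℂ) ^ 2) • (1 : A) := by
      have : star b = b := hb
      simp only [star_add, this, star_smul, star_one, add_mul, mul_add, smul_mul_assoc, mul_smul_comm,
        one_mul, mul_one]
      simp only [RCLike.star_def, map_mul, Complex.conj_I, Complex.conj_ofReal]
      have h3 : (-Complex.I * t) * (Complex.I * t) = (t : ℂ) ^ 2 := by
        linear_combination (-(t:ℂ) ^ 2) * Complex.I_sq
      rw [smul_add, smul_smul, mul_comm (Complex.I * (t : ℂ)), h3, neg_mul, neg_smul]
      abel
    have e3 : ‖b + (Complex.I * t) • (1 : A)‖ ^ 2 ≤ ‖b‖ ^ 2 * ‖(1 : A)‖ + t ^ 2 * ‖(1 : A)‖ := by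
      rw [sq, ← CStarRing.norm_star_mul_self, e2]
      refine (norm_add_le _ _).trans ?_
      have := norm_mul_le (b * b) (1 : A)
      rw [mul_one] at this
      have h4 := norm_mul_le b b
      have h5 : ‖((t : ℂ) ^ 2) • (1 : A)‖ = t ^ 2 * ‖(1 : A)‖ := by
        rw [norm_smul]; simp
      rw [h5]
      nlinarith [norm_nonneg (1 : A)]
    have e4 : ‖φ (b + (Complex.I * t) • (1 : A))‖ ≤ ‖b + (Complex.I * t) • (1 : A)‖ := by
      refine (φ.le_opNorm _).trans ?_
      nlinarith [norm_nonneg (b + (Complex.I * t) • (1 : A))]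
    have e5 : (φ b).im + t = (φ (b + (Complex.I * t) • (1 : A))).im := by
      rw [e1]; simp
    have e6 := Complex.abs_im_le_norm (φ (b + (Complex.I * t) • (1 : A)))
    rw [e5]
    calc _ = |(φ (b + (Complex.I * t) • (1 : A))).im| ^ 2 := by rw [sq_abs]
      _ ≤ ‖b + (Complex.I * t) • (1 : A)‖ ^ 2 := by
        gcongr; exact e6.trans e4
      _ ≤ _ := e3
  rcases subsingleton_or_nontrivial A with hA | hA
  · rw [Subsingleton.elim b 0]; simp
  · simp only [CStarRing.norm_one, mul_one] at key
    by_contra hne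
    have := key ((‖b‖ ^ 2 + 1) / (2 * (φ b).im))
    have h7 : 2 * (φ b).im * ((‖b‖ ^ 2 + 1) / (2 * (φ b).im)) = ‖b‖ ^ 2 + 1 := by
      field_simp
    nlinarith [sq_nonneg (φ b).im]

variable [PartialOrder A] [StarOrderedRing A]

lemma pos_of_norm (φ : A →L[ℂ] ℂ) (hφ : ‖φ‖ ≤ 1) (h1 : φ 1 = 1) (b : A) (hb : 0 ≤ b) :
    0 ≤ φ b := by
  have him := im_zero φ hφ h1 b (.of_nonneg hb)
  rw [Complex.nonneg_iff]
  refine ⟨?_, him.symm⟩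
  have h2 : ‖algebraMap ℝ A ‖b‖ - b‖ ≤ ‖b‖ := by
    have hsa : IsSelfAdjoint b := .of_nonneg hb
    have hle : b ≤ algebraMap ℝ A ‖b‖ := hsa.le_algebraMap_norm_self
    rw [CStarAlgebra.norm_le_iff_le_algebraMap _ (norm_nonneg _) (sub_nonneg.2 hle)]
    simpa using hb
  have h3 : φ (algebraMap ℝ A ‖b‖ - b) = ‖b‖ - φ b := by
    rw [map_sub, Algebra.algebraMap_eq_smul_one, ← Complex.coe_smul, map_smul, h1]; simp
  have h4 : ‖φ (algebraMap ℝ A ‖b‖ - b)‖ ≤ ‖b‖ := by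
    refine (φ.le_opNorm _).trans ?_
    nlinarith [norm_nonneg (algebraMap ℝ A ‖b‖ - b)]
  have h5 := (Complex.re_le_norm _).trans h4
  rw [h3] at h5
  simp at h5
  exact h5

lemma exists_norming [Nontrivial A] (h : A) (hh : 0 ≤ h) :
    ∃ φ : A →L[ℂ] ℂ, ‖φ‖ ≤ 1 ∧ φ 1 = 1 ∧ φ h = ‖h‖ := by
  by_cases h0 : h = 0
  · obtain ⟨g, hg, hg1⟩ := exists_dual_vector ℂ (1 : A) (by simp)
    refine ⟨g, hg.le, by simpa using hg1, by simp [h0]⟩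
  · have hpos : 0 < ‖h‖ := norm_pos_iff.2 h0
    set x : A := algebraMap ℝ A ‖h‖ + h with hx
    have hxn : 2 * ‖h‖ ≤ ‖x‖ := by
      have h1 : ‖h‖ ∈ spectrum ℝ h := CStarAlgebra.norm_mem_spectrum_of_nonneg hh
      have h2 : ‖h‖ + ‖h‖ ∈ spectrum ℝ x := spectrum.add_mem_add_iff.2 h1
      have := spectrum.norm_le_norm_of_mem h2
      rw [Real.norm_of_nonneg (by positivity)] at this
      linarith
    have hx0 : x ≠ 0 := by rw [← norm_pos_iff]; linarith
    obtain ⟨g, hg, hg1⟩ := exists_dual_vector ℂ x (norm_ne_zero_iff.2 hx0)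
    have hgx : g x = ‖h‖ * g 1 + g h := by
      rw [hx, map_add, Algebra.algebraMap_eq_smul_one, ← Complex.coe_smul, map_smul]; simp
    have n1 : ‖g 1‖ ≤ 1 := by simpa [hg] using g.le_opNorm 1
    have nh : ‖g h‖ ≤ ‖h‖ := by simpa [hg] using g.le_opNorm h
    have re := congrArg Complex.re (hgx.symm.trans hg1)
    simp at re
    have r1 := (Complex.re_le_norm (g 1)).trans n1
    have rh := (Complex.re_le_norm (g h)).trans nh
    have r1' : (g 1).re = 1 := by nlinarith
    have rh' : (g h).re = ‖h‖ := by nlinarith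
    have aux : ∀ (z : ℂ) (r : ℝ), 0 ≤ r → ‖z‖ ≤ r → z.re = r → z = r := by
      intro z r hr hz hzr
      have := Complex.sq_norm z
      rw [Complex.normSq_apply] at this
      have : z.im = 0 := by
        have : z.im * z.im ≤ 0 := by nlinarith [norm_nonneg z]
        nlinarith [mul_self_eq_zero.1 (le_antisymm this (mul_self_nonneg _))]
      exact Complex.ext (by simpa using hzr) (by simpa using this)
    exact ⟨g, hg.le, by simpa using aux _ 1 zero_le_one n1 r1', aux _ _ hpos.le nh rh'⟩

lemma norm_apply_le (f : A →ₚ[ℂ] ℂ) (h1 : f 1 = 1) (a : A) : ‖f a‖ ≤ ‖a‖ := by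
  have e1 : ‖f.toPreGNS 1‖ = 1 := by
    rw [PositiveLinearMap.preGNS_norm_def]; simp [h1]
  have e2 : ‖f.toPreGNS a‖ ≤ ‖a‖ := by
    have : f.toPreGNS a = f.leftMulMapPreGNS a (f.toPreGNS 1) := by simp
    rw [this]
    refine (ContinuousLinearMap.le_opNorm _ _).trans ?_
    rw [e1, mul_one]
    exact LinearMap.mkContinuous_norm_le _ (norm_nonneg _) _
  have e3 : f a = ⟪f.toPreGNS 1, f.toPreGNS a⟫_ℂ := by
    rw [PositiveLinearMap.preGNS_inner_def]; simp
  rw [e3]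
  refine (norm_inner_le_norm _ _).trans ?_
  rw [e1, one_mul]; exact e2

noncomputable def xi (f : A →ₚ[ℂ] ℂ) : f.GNS := (f.toPreGNS 1 : f.GNS)

lemma gns_xi (f : A →ₚ[ℂ] ℂ) (a : A) : f.gnsStarAlgHom a (xi f) = (f.toPreGNS a : f.GNS) := by
  simp [xi]

lemma norm_xi (f : A →ₚ[ℂ] ℂ) (h1 : f 1 = 1) : ‖xi f‖ = 1 := by
  rw [xi, UniformSpace.Completion.norm_coe, PositiveLinearMap.preGNS_norm_def]; simp [h1]

lemma inner_gns (f : A →ₚ[ℂ] ℂ) (a b : A) :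
    ⟪f.gnsStarAlgHom a (xi f), f.gnsStarAlgHom b (xi f)⟫_ℂ = f (star a * b) := by
  rw [gns_xi, gns_xi, UniformSpace.Completion.inner_coe, PositiveLinearMap.preGNS_inner_def]; simp

lemma dense_ext (f : A →ₚ[ℂ] ℂ) (S T : f.GNS →L[ℂ] f.GNS)
    (h : ∀ a b : A, ⟪f.gnsStarAlgHom a (xi f), S (f.gnsStarAlgHom b (xi f))⟫_ℂ =
      ⟪f.gnsStarAlgHom a (xi f), T (f.gnsStarAlgHom b (xi f))⟫_ℂ) : S = T := by
  ext x
  refine ext_inner_left ℂ fun y => ?_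
  induction y, x using UniformSpace.Completion.induction_on₂ with
  | hp => apply isClosed_eq <;> fun_prop
  | ih y x =>
    have := h (f.ofPreGNS y) (f.ofPreGNS x)
    rw [gns_xi, gns_xi] at this
    simpa using this

/-- states attaining the norm at h -/
def face (h : A) : Set (WeakDual ℂ A) :=
  {φ | φ 1 = 1 ∧ (∀ a : A, 0 ≤ φ (star a * a)) ∧ φ h = ‖h‖}

lemma pos_of_face (φ : WeakDual ℂ A) (hp : ∀ a : A, 0 ≤ φ (star a * a)) (b : A) (hb : 0 ≤ b) :
    0 ≤ φ b := by
  obtain ⟨c, rfl⟩ := CStarAlgebra.nonneg_iff_eq_star_mul_self.1 hb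
  exact hp c

noncomputable def toPos (φ : WeakDual ℂ A) (hp : ∀ a : A, 0 ≤ φ (star a * a)) : A →ₚ[ℂ] ℂ :=
  PositiveLinearMap.mk₀ (WeakDual.toStrongDual φ : A →L[ℂ] ℂ).toLinearMap (pos_of_face φ hp)

lemma toPos_apply (φ : WeakDual ℂ A) (hp : ∀ a : A, 0 ≤ φ (star a * a)) (a : A) :
    toPos φ hp a = φ a := rfl

lemma state_norm_le (φ : WeakDual ℂ A) (h1 : φ 1 = 1) (hp : ∀ a : A, 0 ≤ φ (star a * a)) (a : A) :
    ‖φ a‖ ≤ ‖a‖ := by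
  have := norm_apply_le (toPos φ hp) (by rw [toPos_apply, h1]) a
  rwa [toPos_apply] at this

lemma face_compact (h : A) : IsCompact (face h) := by
  apply WeakDual.isCompact_of_bounded_of_closed
  · rw [← WeakDual.isBounded_toWeakDual_preimage_iff_isBounded, isBounded_iff_forall_norm_le]
    refine ⟨1, fun φ hφ => ?_⟩
    refine ContinuousLinearMap.opNorm_le_bound _ zero_le_one fun x => ?_
    rw [one_mul]
    exact state_norm_le (StrongDual.toWeakDual φ) hφ.1 hφ.2.1 x
  · have hc : ∀ x : A, Continuous fun φ : WeakDual ℂ A => φ x := WeakDual.eval_continuous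
    have e : face h = {φ | φ 1 = 1} ∩ ((⋂ a : A, {φ | (0 : ℂ) ≤ φ (star a * a)}) ∩ {φ | φ h = (‖h‖ : ℂ)}) := by
      ext φ; simp [face]
    rw [e]
    exact (isClosed_eq (hc 1) continuous_const).inter (IsClosed.inter
      (isClosed_iInter fun a => isClosed_le continuous_const (hc _))
      (isClosed_eq (hc h) continuous_const))

lemma face_nonempty [Nontrivial A] (h : A) (hh : 0 ≤ h) : (face h).Nonempty := by
  obtain ⟨φ, h1, h2, h3⟩ := exists_norming h hh
  exact ⟨StrongDual.toWeakDual φ, h2, fun a => pos_of_norm φ h1 h2 _ (star_mul_self_nonneg a), h3⟩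

lemma exists_extreme [Nontrivial A] (h : A) (hh : 0 ≤ h) :
    ((face h).extremePoints ℝ).Nonempty := by
  have : IsScalarTower ℝ ℂ (WeakDual ℂ A) :=
    ⟨fun r z φ => DFunLike.ext _ _ fun a => smul_mul_assoc r z (φ a)⟩
  have : LocallyConvexSpace ℝ (WeakDual ℂ A) := (WeakDual.withSeminorms ℂ A).toLocallyConvexSpace
  exact (face_compact h).extremePoints_nonempty (face_nonempty h hh)

noncomputable def orbit (f : A →ₚ[ℂ] ℂ) : A →L[ℂ] f.GNS :=
  LinearMap.mkContinuous
    { toFun := fun a => f.gnsStarAlgHom a (xi f)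
      map_add' := fun a b => by simp only [map_add, add_apply]
      map_smul' := fun c a => by
        simp only [map_smul, smul_apply, RingHom.id_apply] } ‖xi f‖ fun a => by
    refine (ContinuousLinearMap.le_opNorm (f.gnsStarAlgHom a) (xi f)).trans ?_
    rw [mul_comm]
    gcongr
    exact NonUnitalStarAlgHom.norm_apply_le f.gnsStarAlgHom a

lemma orbit_apply (f : A →ₚ[ℂ] ℂ) (a : A) : orbit f a = f.gnsStarAlgHom a (xi f) := rfl

/-- the functional `a ↦ ⟪ξ, R π(a) ξ⟫` divided by its value at `1`. -/
noncomputable def vecFun (f : A →ₚ[ℂ] ℂ) (R : f.GNS →L[ℂ] f.GNS) : WeakDual ℂ A :=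
  StrongDual.toWeakDual ((⟪xi f, R (xi f)⟫_ℂ)⁻¹ • ((innerSL ℂ (xi f)) ∘L R ∘L orbit f))

lemma vecFun_apply (f : A →ₚ[ℂ] ℂ) (R : f.GNS →L[ℂ] f.GNS) (a : A) :
    vecFun f R a = (⟪xi f, R (xi f)⟫_ℂ)⁻¹ * ⟪xi f, R (f.gnsStarAlgHom a (xi f))⟫_ℂ := rfl

lemma inner_comm (f : A →ₚ[ℂ] ℂ) (R : f.GNS →L[ℂ] f.GNS)
    (hR : ∀ a : A, R * f.gnsStarAlgHom a = f.gnsStarAlgHom a * R) (a b : A) :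
    ⟪xi f, R (f.gnsStarAlgHom (star a * b) (xi f))⟫_ℂ =
      ⟪f.gnsStarAlgHom a (xi f), R (f.gnsStarAlgHom b (xi f))⟫_ℂ := by
  have h1 : R (f.gnsStarAlgHom (star a * b) (xi f)) =
      f.gnsStarAlgHom (star a) (R (f.gnsStarAlgHom b (xi f))) := by
    have := congrArg (fun S => S (f.gnsStarAlgHom b (xi f))) (hR (star a))
    simp only [mul_apply_eq_comp] at this
    rw [← this, map_mul, mul_apply_eq_comp]
  rw [h1, map_star, ContinuousLinearMap.star_eq_adjoint, ContinuousLinearMap.adjoint_inner_right]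

lemma vecFun_state (f : A →ₚ[ℂ] ℂ) (R : f.GNS →L[ℂ] f.GNS)
    (hR : ∀ a : A, R * f.gnsStarAlgHom a = f.gnsStarAlgHom a * R)
    (hpos : ∀ x, 0 ≤ ⟪x, R x⟫_ℂ) (h0 : ⟪xi f, R (xi f)⟫_ℂ ≠ 0) :
    vecFun f R 1 = 1 ∧ ∀ a : A, 0 ≤ vecFun f R (star a * a) := by
  refine ⟨?_, fun a => ?_⟩
  · rw [vecFun_apply, map_one, one_apply_eq_self, inv_mul_cancel₀ h0]
  · rw [vecFun_apply, inner_comm f R hR]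
    exact mul_nonneg (inv_nonneg.2 (hpos _)) (hpos _)

lemma scalar_of_selfAdjoint (h : A) (φ : WeakDual ℂ A) (hφ : φ ∈ (face h).extremePoints ℝ)
    (T : (toPos φ hφ.1.2.1).GNS →L[ℂ] (toPos φ hφ.1.2.1).GNS) (hT : IsSelfAdjoint T)
    (hc : ∀ a : A, T * (toPos φ hφ.1.2.1).gnsStarAlgHom a = (toPos φ hφ.1.2.1).gnsStarAlgHom a * T) :
    ∃ c : ℂ, T = c • (1 : (toPos φ hφ.1.2.1).GNS →L[ℂ] (toPos φ hφ.1.2.1).GNS) := by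
  have hf : ∀ a, toPos φ hφ.1.2.1 a = φ a := fun a => rfl
  obtain ⟨h1, hp, hh⟩ := hφ.1
  generalize toPos φ hφ.1.2.1 = f at *
  have hf1 : f 1 = 1 := by rw [hf, h1]
  have hxi := norm_xi f hf1
  set c : ℝ := (4 * (‖T‖ + 1))⁻¹ with hcdef
  have hTn := norm_nonneg T
  have hcpos : 0 < c := by positivity
  have hcT : c * ‖T‖ ≤ 1 / 4 := by
    rw [hcdef, inv_mul_le_iff₀ (by positivity)]; linarith
  -- quadratic form of T is real
  have hreal : ∀ x, ⟪x, T x⟫_ℂ = ((⟪x, T x⟫_ℂ).re : ℂ) := by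
    intro x
    have : (starRingEnd ℂ) ⟪x, T x⟫_ℂ = ⟪x, T x⟫_ℂ := by
      rw [inner_conj_symm]
      exact hT.isSymmetric x x
    exact (Complex.conj_eq_iff_re.1 this).symm
  have hbd : ∀ x, |(⟪x, T x⟫_ℂ).re| ≤ ‖T‖ * ‖x‖ ^ 2 := by
    intro x
    refine (Complex.abs_re_le_norm _).trans ((norm_inner_le_norm _ _).trans ?_)
    nlinarith [T.le_opNorm x, norm_nonneg x]
  -- the two parts
  have main : ∀ s : ℝ, |s| = c →
      (∀ a : A, ((1 / 2 : ℂ) • (1 : f.GNS →L[ℂ] f.GNS) + (s : ℂ) • T) * f.gnsStarAlgHom a =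
        f.gnsStarAlgHom a * ((1 / 2 : ℂ) • (1 : f.GNS →L[ℂ] f.GNS) + (s : ℂ) • T)) ∧
      (∀ x, ⟪x, ((1 / 2 : ℂ) • (1 : f.GNS →L[ℂ] f.GNS) + (s : ℂ) • T) x⟫_ℂ =
        ((1 / 2 * ‖x‖ ^ 2 + s * (⟪x, T x⟫_ℂ).re : ℝ) : ℂ)) ∧
      (∀ x, 1 / 4 * ‖x‖ ^ 2 ≤ 1 / 2 * ‖x‖ ^ 2 + s * (⟪x, T x⟫_ℂ).re) := by
    intro s hs
    refine ⟨fun a => ?_, fun x => ?_, fun x => ?_⟩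
    · simp only [add_mul, mul_add, smul_mul_assoc, mul_smul_comm, one_mul, mul_one, hc]
    · simp only [add_apply, smul_apply,
        one_apply_eq_self, inner_add_right, inner_smul_right,
        inner_self_eq_norm_sq_to_K]
      rw [hreal x]
      push_cast
      simp
    · have h5 : |s * (⟪x, T x⟫_ℂ).re| ≤ 1 / 4 * ‖x‖ ^ 2 := by
        rw [abs_mul, hs]
        calc c * |(⟪x, T x⟫_ℂ).re| ≤ c * (‖T‖ * ‖x‖ ^ 2) := by gcongr; exact hbd x
          _ = (c * ‖T‖) * ‖x‖ ^ 2 := by ring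
          _ ≤ _ := by gcongr
      linarith [neg_abs_le (s * (⟪x, T x⟫_ℂ).re)]
  obtain ⟨c1, f1, p1⟩ := main c (abs_of_pos hcpos)
  obtain ⟨c2, f2, p2⟩ := main (-c) (by rw [abs_neg, abs_of_pos hcpos])
  set Q := (1 / 2 : ℂ) • (1 : f.GNS →L[ℂ] f.GNS) + (c : ℂ) • T with hQ
  set Q' := (1 / 2 : ℂ) • (1 : f.GNS →L[ℂ] f.GNS) + ((-c : ℝ) : ℂ) • T with hQ'
  have hsum : ∀ y, Q y + Q' y = y := by
    intro y
    have : Q + Q' = 1 := by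
      rw [hQ, hQ']; push_cast; module
    rw [← add_apply, this, one_apply_eq_self]
  set t : ℝ := 1 / 2 + c * (⟪xi f, T (xi f)⟫_ℂ).re with ht
  have t1 : ⟪xi f, Q (xi f)⟫_ℂ = (t : ℂ) := by rw [f1, hxi, ht]; simp
  have t2 : ⟪xi f, Q' (xi f)⟫_ℂ = ((1 - t : ℝ) : ℂ) := by
    rw [f2, hxi, ht]; congr 1; ring
  have t1p : 0 < t := by have := p1 (xi f); rw [hxi] at this; rw [ht]; linarith
  have t2p : 0 < 1 - t := by have := p2 (xi f); rw [hxi] at this; rw [ht]; linarith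
  have pos1 : ∀ x, 0 ≤ ⟪x, Q x⟫_ℂ := fun x => by
    rw [f1]; exact Complex.zero_le_real.2 (le_trans (by positivity) (p1 x))
  have pos2 : ∀ x, 0 ≤ ⟪x, Q' x⟫_ℂ := fun x => by
    rw [f2]; exact Complex.zero_le_real.2 (le_trans (by positivity) (p2 x))
  have t1c : (t : ℂ) ≠ 0 := by exact_mod_cast t1p.ne'
  have t2c : ((1 - t : ℝ) : ℂ) ≠ 0 := by exact_mod_cast t2p.ne'
  obtain ⟨s1, s1'⟩ := vecFun_state f Q c1 pos1 (by rw [t1]; exact t1c)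
  obtain ⟨s2, s2'⟩ := vecFun_state f Q' c2 pos2 (by rw [t2]; exact t2c)
  have comb : ∀ a : A, (t : ℂ) * vecFun f Q a + ((1 - t : ℝ) : ℂ) * vecFun f Q' a = φ a := by
    intro a
    rw [vecFun_apply, vecFun_apply, t1, t2, mul_inv_cancel_left₀ t1c, mul_inv_cancel_left₀ t2c,
      ← inner_add_right, hsum, ← hf]
    have := inner_gns f 1 a
    simpa using this
  have n1 := state_norm_le _ s1 s1' h
  have n2 := state_norm_le _ s2 s2' h
  have aux : ∀ (z : ℂ) (r : ℝ), 0 ≤ r → ‖z‖ ≤ r → r ≤ z.re → z = r := by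
    intro z r hr hz hzr
    have h6 := Complex.sq_norm z
    have h8 := (Complex.re_le_norm z)
    rw [Complex.normSq_apply] at h6
    have : z.im = 0 := by
      have : z.im * z.im ≤ 0 := by nlinarith [norm_nonneg z]
      exact mul_self_eq_zero.1 (le_antisymm this (mul_self_nonneg _))
    exact Complex.ext (by simp; linarith) (by simpa using this)
  have re := congrArg Complex.re ((comb h).trans hh)
  rw [Complex.add_re, Complex.re_ofReal_mul, Complex.re_ofReal_mul, Complex.ofReal_re] at re
  have r1 := (Complex.re_le_norm _).trans n1
  have r2 := (Complex.re_le_norm _).trans n2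
  have m1 : vecFun f Q ∈ face h := ⟨s1, s1', aux _ _ (norm_nonneg _) n1 (by nlinarith)⟩
  have m2 : vecFun f Q' ∈ face h := ⟨s2, s2', aux _ _ (norm_nonneg _) n2 (by nlinarith)⟩
  have heq : vecFun f Q = φ := by
    refine hφ.2 m1 m2 ⟨t, 1 - t, t1p, t2p, by ring, ?_⟩
    refine DFunLike.ext _ _ fun a => ?_
    rw [← comb a]
    change t • vecFun f Q a + (1 - t) • vecFun f Q' a = _
    rw [Complex.real_smul, Complex.real_smul]
  have hQt : Q = (t : ℂ) • (1 : f.GNS →L[ℂ] f.GNS) := by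
    refine dense_ext f _ _ fun a b => ?_
    rw [← inner_comm f Q c1, smul_apply, one_apply_eq_self,
      inner_smul_right, inner_gns, hf, ← heq, vecFun_apply, t1, mul_inv_cancel_left₀ t1c]
  have hcc : (c : ℂ) ≠ 0 := by exact_mod_cast hcpos.ne'
  refine ⟨(c : ℂ)⁻¹ * (t - 1 / 2), ?_⟩
  have : (c : ℂ) • T = ((t : ℂ) - 1 / 2) • (1 : f.GNS →L[ℂ] f.GNS) := by
    rw [sub_smul, ← hQt, hQ]; abel
  rw [mul_smul, ← this, smul_smul, inv_mul_cancel₀ hcc, one_smul]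

end

section final
variable {A : Type} [CStarAlgebra A] [PartialOrder A] [StarOrderedRing A]

lemma irreducible_of {H : Type} [NormedAddCommGroup H] [InnerProductSpace ℂ H] [CompleteSpace H]
    (π : A →⋆ₐ[ℂ] (H →L[ℂ] H)) (hH : Nontrivial H)
    (hsa : ∀ T : H →L[ℂ] H, IsSelfAdjoint T → (∀ a : A, T * π a = π a * T) →
      ∃ c : ℂ, T = c • (1 : H →L[ℂ] H)) : IsIrreducibleRep A H π := by
  refine ⟨hH, fun T hT => ?_⟩
  have hT' : ∀ a : A, star T * π a = π a * star T := by
    intro a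
    have := congrArg star (hT (star a))
    rw [star_mul, star_mul, map_star, star_star] at this
    exact this.symm
  obtain ⟨c, hc⟩ := hsa (T + star T)
    (IsSelfAdjoint.add_star_self T) (fun a => by rw [add_mul, mul_add, hT, hT'])
  obtain ⟨d, hd⟩ := hsa (Complex.I • (T - star T))
    (by
      rw [isSelfAdjoint_iff, star_smul, star_sub, star_star]
      simp only [RCLike.star_def, Complex.conj_I, neg_smul, ← smul_neg, neg_sub]) (fun a => by
      rw [smul_mul_assoc, mul_smul_comm, sub_mul, mul_sub, hT, hT'])
  refine ⟨c / 2 - Complex.I * d / 2, ?_⟩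
  have e : T = (1 / 2 : ℂ) • (T + star T) - (Complex.I / 2) • (Complex.I • (T - star T)) := by
    rw [smul_smul]
    have : Complex.I / 2 * Complex.I = -(1 / 2) := by linear_combination Complex.I_sq / 2
    rw [this]; module
  rw [e, hc, hd, smul_smul, smul_smul, ← sub_smul]
  congr 1
  ring

lemma exists_rep [Nontrivial A] (h : A) (hh : 0 ≤ h) :
    ∃ f : A →ₚ[ℂ] ℂ, f 1 = 1 ∧ f h = ‖h‖ ∧ IsIrreducibleRep A f.GNS f.gnsStarAlgHom := by
  obtain ⟨φ, hφ⟩ := exists_extreme h hh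
  have hsa := scalar_of_selfAdjoint h φ hφ
  have h1 : toPos φ hφ.1.2.1 1 = 1 := hφ.1.1
  have h2 : toPos φ hφ.1.2.1 h = ‖h‖ := hφ.1.2.2
  generalize toPos φ hφ.1.2.1 = f at *
  refine ⟨f, h1, h2, irreducible_of _ ?_ hsa⟩
  have := norm_xi f h1
  refine ⟨xi f, 0, fun h0 => ?_⟩
  rw [h0] at this; simp at this

lemma hs_bound {H : Type*} [NormedAddCommGroup H] [InnerProductSpace ℂ H] {ι : Type*} [Fintype ι]
    (e : OrthonormalBasis ι ℂ H) (S : H →L[ℂ] H) (x : H) (hx : ‖x‖ = 1) :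
    ‖S x‖ ^ 2 ≤ ∑ i, ‖S (e i)‖ ^ 2 := by
  have h1 : S x = ∑ i, ⟪e i, x⟫_ℂ • S (e i) := by
    conv_lhs => rw [← e.sum_repr' x]
    simp
  have h2 : ‖S x‖ ≤ ∑ i, ‖⟪e i, x⟫_ℂ‖ * ‖S (e i)‖ := by
    rw [h1]
    refine (norm_sum_le _ _).trans (le_of_eq ?_)
    simp [norm_smul]
  have h3 : ∑ i, ‖⟪e i, x⟫_ℂ‖ ^ 2 = 1 := by rw [e.sum_sq_norm_inner_right, hx, one_pow]
  calc ‖S x‖ ^ 2 ≤ (∑ i, ‖⟪e i, x⟫_ℂ‖ * ‖S (e i)‖) ^ 2 := by gcongr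
    _ ≤ (∑ i, ‖⟪e i, x⟫_ℂ‖ ^ 2) * ∑ i, ‖S (e i)‖ ^ 2 := Finset.sum_mul_sq_le_sq_mul_sq _ _ _
    _ = _ := by rw [h3, one_mul]

lemma exists_trace {H : Type} [NormedAddCommGroup H] [InnerProductSpace ℂ H] [CompleteSpace H]
    (π : A →⋆ₐ[ℂ] (H →L[ℂ] H)) (n : ℕ) (hn : 0 < n) (hH : Module.finrank ℂ H = n)
    (x : H) (hx : ‖x‖ = 1) (a : A) :
    ∃ τ ∈ tracialStates A, ‖π a x‖ ^ 2 / n ≤ (τ (star a * a)).re := by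
  have : FiniteDimensional ℂ H := Module.finite_of_finrank_pos (by omega)
  have hnc : (n : ℂ) ≠ 0 := by exact_mod_cast hn.ne'
  let L : (H →L[ℂ] H) →ₗ[ℂ] ℂ := (LinearMap.trace ℂ H) ∘ₗ (ContinuousLinearMap.coeLM ℂ)
  have hLapp : ∀ S, L S = LinearMap.trace ℂ H (S : H →ₗ[ℂ] H) := fun S => rfl
  have hLc : Continuous (L ∘ₗ π.toAlgHom.toLinearMap) := by
    have h1 : Continuous L := L.continuous_of_finiteDimensional
    have h2 : Continuous π := map_continuous π
    exact h1.comp h2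
  let τ : WeakDual ℂ A := StrongDual.toWeakDual ((n : ℂ)⁻¹ • (⟨L ∘ₗ π.toAlgHom.toLinearMap, hLc⟩ : A →L[ℂ] ℂ))
  have hτ : ∀ b, τ b = (n : ℂ)⁻¹ * LinearMap.trace ℂ H (π b : H →ₗ[ℂ] H) := fun b => rfl
  let e := stdOrthonormalBasis ℂ H
  have hpos : ∀ b, τ (star b * b) = (((n : ℝ)⁻¹ * ∑ i, ‖π b (e i)‖ ^ 2 : ℝ) : ℂ) := by
    intro b
    rw [hτ, LinearMap.trace_eq_sum_inner _ e]
    push_cast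
    congr 1
    refine Finset.sum_congr rfl fun i _ => ?_
    rw [map_mul, map_star, mul_apply_eq_comp,
      ContinuousLinearMap.star_eq_adjoint, ContinuousLinearMap.adjoint_inner_right,
      inner_self_eq_norm_sq_to_K]
    rfl
  refine ⟨τ, ⟨?_, fun b => ?_, fun b c => ?_⟩, ?_⟩
  · rw [hτ, map_one]
    have : LinearMap.trace ℂ H ((1 : H →L[ℂ] H) : H →ₗ[ℂ] H) = n := by
      rw [← hH]; exact LinearMap.trace_one ℂ H
    rw [this, inv_mul_cancel₀ hnc]
  · rw [hpos, Complex.ofReal_re, Complex.ofReal_im]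
    exact ⟨by positivity, rfl⟩
  · rw [hτ, hτ, map_mul, map_mul]
    congr 1
    exact LinearMap.trace_mul_comm ℂ (π b : H →ₗ[ℂ] H) (π c : H →ₗ[ℂ] H)
  · rw [hpos, Complex.ofReal_re, div_eq_inv_mul]
    gcongr
    exact hs_bound e _ x hx

lemma trace_le (τ : WeakDual ℂ A) (hτ : τ ∈ tracialStates A) (a : A) :
    Real.sqrt (τ (star a * a)).re ≤ ‖a‖ := by
  rw [Real.sqrt_le_left (norm_nonneg _), sq, ← CStarRing.norm_star_mul_self]
  exact (Complex.re_le_norm _).trans (state_norm_le τ hτ.1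
    (fun b => Complex.nonneg_iff.2 ⟨(hτ.2.1 b).1, (hτ.2.1 b).2.symm⟩) _)

lemma main (n : ℕ) (hn : 0 < n)
    (hhom : ∀ (H : Type) (_ : NormedAddCommGroup H) (_ : InnerProductSpace ℂ H)
      (_ : CompleteSpace H) (π : A →⋆ₐ[ℂ] (H →L[ℂ] H)),
      IsIrreducibleRep A H π → Module.finrank ℂ H = n)
    (a : A) :
    (Real.sqrt n)⁻¹ * ‖a‖ ≤ norm2 (tracialStates A) a ∧
      norm2 (tracialStates A) a ≤ ‖a‖ := by
  have hub : ∀ y ∈ (fun φ : WeakDual ℂ A => Real.sqrt (φ (star a * a)).re) '' tracialStates A,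
      y ≤ ‖a‖ := by
    rintro _ ⟨τ, hτ, rfl⟩
    exact trace_le τ hτ a
  have hnn : 0 ≤ norm2 (tracialStates A) a := by
    refine Real.sSup_nonneg ?_
    rintro _ ⟨τ, hτ, rfl⟩
    exact Real.sqrt_nonneg _
  refine ⟨?_, Real.sSup_le hub (norm_nonneg _)⟩
  rcases subsingleton_or_nontrivial A with hA | hA
  · have : a = 0 := Subsingleton.elim _ _
    simpa [this] using hnn
  obtain ⟨f, hf1, hfh, hirr⟩ := exists_rep (star a * a) (star_mul_self_nonneg a)
  have hfin := hhom _ _ _ _ _ hirr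
  obtain ⟨τ, hτ, hle⟩ := exists_trace f.gnsStarAlgHom n hn hfin (xi f) (norm_xi f hf1) a
  refine le_trans ?_ (le_csSup ⟨‖a‖, hub⟩ ⟨τ, hτ, rfl⟩)
  have h1 : ‖f.gnsStarAlgHom a (xi f)‖ ^ 2 = ‖a‖ ^ 2 := by
    have h2 := inner_gns f a a
    rw [inner_self_eq_norm_sq_to_K, hfh, CStarRing.norm_star_mul_self] at h2
    rw [sq ‖a‖]
    apply Complex.ofReal_injective
    rw [← h2, Complex.ofReal_pow]
    rfl
  rw [h1] at hle
  refine Real.le_sqrt_of_sq_le (le_trans (le_of_eq ?_) hle)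
  rw [mul_pow, inv_pow, Real.sq_sqrt (Nat.cast_nonneg n), div_eq_inv_mul]

end final
end HomNorm

/-- If `A` is a unital `n`-homogeneous C*-algebra (every irreducible representation has
dimension `n`), then `n^{-1/2}‖a‖ ≤ ‖a‖_{2,T(A)} ≤ ‖a‖` for every `a ∈ A`; in particular
the C*-norm and the uniform tracial 2-norm are equivalent. -/
theorem homogeneous_norm_equivalence
    (A : Type) [NormedRing A] [StarRing A] [CStarRing A] [NormedAlgebra ℂ A]
    [CompleteSpace A] [StarModule ℂ A] (n : ℕ) (hn : 0 < n)
    (hhom : ∀ (H : Type) (_ : NormedAddCommGroup H) (_ : InnerProductSpace ℂ H)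
      (_ : CompleteSpace H) (π : A →⋆ₐ[ℂ] (H →L[ℂ] H)),
      IsIrreducibleRep A H π → Module.finrank ℂ H = n)
    (a : A) :
    (Real.sqrt n)⁻¹ * ‖a‖ ≤ norm2 (tracialStates A) a ∧
      norm2 (tracialStates A) a ≤ ‖a‖ := by
  let _ : CStarAlgebra A := { }
  let _ : PartialOrder A := CStarAlgebra.spectralOrder A
  have : StarOrderedRing A := CStarAlgebra.spectralOrderedRing A
  exact HomNorm.main n hn hhom a
end

section
/- Let A be a unital C*-algebra whose tracial state space T(A) is nonempty, and let A_0 be the Cuntz–Pedersen nullset of A. Then for a ∈ A, every tracial state vanishes on a if and only if a ∈ A_0; consequently, sup_{τ∈T(A)} τ(a*a) = dist(a*a, A_0). -/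
/-- The Cuntz–Pedersen nullset: the norm closure of the linear span of the self-adjoint
commutators `[a, a*] = a a* − a* a`. -/
def cuntzPedersenNullset (A : Type*) [NormedRing A] [StarRing A] [NormedAlgebra ℂ A] :
    Set A :=
  closure (Submodule.span ℂ {x : A | ∃ b : A, x = b * star b - star b * b} : Set A)

namespace CPNull

/-- The linear span of the self-adjoint commutators. -/
noncomputable def N (A : Type*) [NormedRing A] [StarRing A] [NormedAlgebra ℂ A] : Submodule ℂ A :=
  Submodule.span ℂ {x : A | ∃ b : A, x = b * star b - star b * b}

/-- Pairs `(∑ z* z, ∑ z z*)`. -/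
def E (A : Type*) [NormedRing A] [StarRing A] : AddSubmonoid (A × A) :=
  AddSubmonoid.closure (Set.range fun z : A => (star z * z, z * star z))

section
variable {A : Type*} [CStarAlgebra A]

lemma comm_mem (x y : A) : x * y - y * x ∈ N A := by
  have g : ∀ b : A, b * star b - star b * b ∈ N A := fun b => Submodule.subset_span ⟨b, rfl⟩
  have key : x * y - y * x = (1 / 4 : ℂ) • (
      ((x + star y) * star (x + star y) - star (x + star y) * (x + star y))
      - ((x - star y) * star (x - star y) - star (x - star y) * (x - star y))
      + Complex.I • ((x + Complex.I • star y) * star (x + Complex.I • star y)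
          - star (x + Complex.I • star y) * (x + Complex.I • star y))
      - Complex.I • ((x - Complex.I • star y) * star (x - Complex.I • star y)
          - star (x - Complex.I • star y) * (x - Complex.I • star y))) := by
    simp only [star_add, star_sub, star_smul, star_star, RCLike.star_def, Complex.conj_I,
      mul_add, add_mul, mul_sub, sub_mul, smul_mul_assoc, mul_smul_comm, smul_add, smul_sub,
      smul_smul, neg_mul, mul_neg, Complex.I_mul_I, neg_smul, smul_neg, one_smul, neg_neg]
    module
  rw [key]
  refine Submodule.smul_mem _ _ (Submodule.sub_mem _ (Submodule.add_mem _ (Submodule.sub_mem _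
    (g _) (g _)) (Submodule.smul_mem _ _ (g _))) (Submodule.smul_mem _ _ (g _)))

lemma E_gen (z : A) : (star z * z, z * star z) ∈ E A := AddSubmonoid.subset_closure ⟨z, rfl⟩

lemma E_swap {p : A × A} (hp : p ∈ E A) : p.swap ∈ E A := by
  induction hp using AddSubmonoid.closure_induction with
  | mem x hx => obtain ⟨z, rfl⟩ := hx; simpa using E_gen (star z)
  | zero => exact (E A).zero_mem
  | add x y _ _ hx hy => exact (E A).add_mem hx hy

lemma E_smul {p : A × A} (hp : p ∈ E A) {r : ℝ} (hr : 0 ≤ r) : r • p ∈ E A := by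
  induction hp using AddSubmonoid.closure_induction with
  | mem x hx =>
    obtain ⟨z, rfl⟩ := hx
    have := E_gen (Real.sqrt r • z)
    simpa [smul_smul, Real.mul_self_sqrt hr] using this
  | zero => simp
  | add x y _ _ hx hy => rw [smul_add]; exact (E A).add_mem hx hy

lemma E_sub_mem {p : A × A} (hp : p ∈ E A) : p.1 - p.2 ∈ N A := by
  induction hp using AddSubmonoid.closure_induction with
  | mem x hx => obtain ⟨z, rfl⟩ := hx; exact comm_mem _ _
  | zero => simp
  | add x y _ _ hx hy =>
    have := (N A).add_mem hx hy
    simpa [add_sub_add_comm] using this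

variable [PartialOrder A] [StarOrderedRing A]

lemma E_diag {x : A} (hx : 0 ≤ x) : (x, x) ∈ E A := by
  obtain ⟨s, hs, rfl⟩ := CStarAlgebra.nonneg_iff_exists_isSelfAdjoint_and_eq_mul_self.1 hx
  simpa [hs.star_eq] using E_gen s

lemma E_nonneg {p : A × A} (hp : p ∈ E A) : 0 ≤ p.1 ∧ 0 ≤ p.2 := by
  induction hp using AddSubmonoid.closure_induction with
  | mem x hx => obtain ⟨z, rfl⟩ := hx; exact ⟨star_mul_self_nonneg _, mul_star_self_nonneg _⟩
  | zero => simp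
  | add x y _ _ hx hy => exact ⟨add_nonneg hx.1 hy.1, add_nonneg hx.2 hy.2⟩

lemma E_map {p : A × A} (hp : p ∈ E A) : ∃ Φ : A →+ A, (∀ e, 0 ≤ e → 0 ≤ Φ e) ∧ Φ 1 = p.2 ∧
    ∀ e, p.1 * e - Φ e ∈ N A := by
  induction hp using AddSubmonoid.closure_induction with
  | mem x hx =>
    obtain ⟨z, rfl⟩ := hx
    refine ⟨(AddMonoidHom.mulRight (star z)).comp (AddMonoidHom.mulLeft z), ?_, ?_, ?_⟩
    · intro e he
      exact star_right_conjugate_nonneg he z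
    · simp
    · intro e
      have := comm_mem (star z) (z * e)
      simpa [mul_assoc] using this
  | zero => exact ⟨0, by simp⟩
  | add x y _ _ hx hy =>
    obtain ⟨f, f1, f2, f3⟩ := hx
    obtain ⟨g, g1, g2, g3⟩ := hy
    refine ⟨f + g, fun e he => add_nonneg (f1 e he) (g1 e he), by simp [f2, g2], fun e => ?_⟩
    have := (N A).add_mem (f3 e) (g3 e)
    simpa [add_mul, add_sub_add_comm] using this

lemma riesz {c d u : A} (hp : (c, d) ∈ E A) (hc : 1 ≤ c) (hu : 0 ≤ u) (huc : u ≤ c) :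
    ∃ v, 0 ≤ v ∧ v ≤ d ∧ u - v ∈ N A := by
  obtain ⟨Φ, h1, h2, h3⟩ := E_map hp
  have hc0 : 0 ≤ c := (E_nonneg hp).1
  have hcu : IsUnit c := CStarAlgebra.isUnit_of_le 1 hc
  obtain ⟨r, hr⟩ := (CFC.isUnit_sqrt_iff c hc0).2 hcu
  have hrc : (r : A) * r = c := by rw [hr]; exact CFC.sqrt_mul_sqrt_self c hc0
  have hrs : star (r : A) = r := by
    rw [hr]; exact (IsSelfAdjoint.of_nonneg (CFC.sqrt_nonneg c)).star_eq
  have hws : star (↑r⁻¹ : A) = ↑r⁻¹ := by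
    have : star r = r := Units.ext hrs
    rw [← Units.coe_star, star_inv, this]
  set w : A := ↑r⁻¹ with hw
  have e0 : 0 ≤ w * u * w := by simpa [hws] using star_right_conjugate_nonneg hu w
  have e1 : w * u * w ≤ 1 := by
    have := star_right_conjugate_le_conjugate huc w
    rw [hws, ← hrc] at this
    simpa [hw, mul_assoc] using this
  refine ⟨Φ (w * u * w), h1 _ e0, ?_, ?_⟩
  · have := h1 _ (sub_nonneg.2 e1)
    rw [map_sub, h2] at this
    exact sub_nonneg.1 this
  · have a1 := comm_mem ((r : A) * (w * u * w)) r
    have a2 := (N A).add_mem a1 (h3 (w * u * w))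
    have : (r : A) * (w * u * w) * r = u := by simp [hw, mul_assoc]
    rw [this, ← mul_assoc, hrc] at a2
    simpa using a2

lemma cancel_step {c d h t : A} (hp : (c, d) ∈ E A) (hd : 1 ≤ d) (hh : 0 ≤ h) (ht : 0 ≤ t)
    (hle : h + c ≤ t + d) (n : ℕ) : ∃ w, 0 ≤ w ∧ w ≤ n • t + d ∧ n • h - w ∈ N A := by
  induction n with
  | zero => exact ⟨0, le_rfl, by simpa using (E_nonneg hp).2, by simp⟩
  | succ n ih =>
    obtain ⟨w, w0, w1, w2⟩ := ih
    have hnt : 0 ≤ n • t + h := add_nonneg (nsmul_nonneg ht n) hh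
    obtain ⟨v, v0, v1, v2⟩ := riesz (c := n • t + h + d) (d := n • t + h + c) (u := w + h)
      ((E A).add_mem (E_diag hnt) (E_swap hp)) (hd.trans (le_add_of_nonneg_left hnt))
      (add_nonneg w0 hh) (by
        calc w + h ≤ n • t + d + h := by gcongr
          _ = _ := by abel)
    refine ⟨v, v0, v1.trans ?_, ?_⟩
    · calc n • t + h + c = n • t + (h + c) := by abel
        _ ≤ n • t + (t + d) := by gcongr
        _ = _ := by rw [succ_nsmul]; abel
    · have := (N A).add_mem w2 v2
      have e : n • h - w + (w + h - v) = (n + 1) • h - v := by rw [succ_nsmul]; abel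
      rwa [e] at this

lemma cancel {c d h : A} {t : ℝ} (hp : (c, d) ∈ E A) (hh : 0 ≤ h) (ht : 0 ≤ t)
    (hle : h + c ≤ algebraMap ℝ A t + d) {ε : ℝ} (hε : 0 < ε) :
    ∃ x ∈ N A, ‖h - x‖ ≤ t + ε := by
  have ht' : (0 : A) ≤ algebraMap ℝ A t := by
    rw [Algebra.algebraMap_eq_smul_one]; exact smul_nonneg ht zero_le_one
  have hp' : (c + 1, d + 1) ∈ E A := (E A).add_mem hp (E_diag zero_le_one)
  have hle' : h + (c + 1) ≤ algebraMap ℝ A t + (d + 1) := by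
    rw [← add_assoc, ← add_assoc]; gcongr
  obtain ⟨n, hn⟩ := exists_nat_gt (‖d + 1‖ / ε)
  have hn0 : (0 : ℝ) < n := lt_of_le_of_lt (by positivity) hn
  obtain ⟨w, w0, w1, w2⟩ := cancel_step hp' (le_add_of_nonneg_left (E_nonneg hp).2) hh ht' hle' n
  have hn0' : (n : ℝ) ≠ 0 := hn0.ne'
  have hn0c : (n : ℂ) ≠ 0 := by exact_mod_cast hn0'
  refine ⟨(n : ℂ)⁻¹ • (n • h - w), (N A).smul_mem _ w2, ?_⟩
  have e : h - (n : ℂ)⁻¹ • (n • h - w) = (n : ℂ)⁻¹ • w := by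
    rw [smul_sub, ← Nat.cast_smul_eq_nsmul ℂ, smul_smul, inv_mul_cancel₀ hn0c, one_smul]; abel
  have hw : ‖w‖ ≤ n * t + ‖d + 1‖ := by
    rw [CStarAlgebra.norm_le_iff_le_algebraMap w (by positivity) w0]
    refine w1.trans ?_
    rw [map_add, map_mul, map_natCast, nsmul_eq_mul]
    gcongr
    exact IsSelfAdjoint.le_algebraMap_norm_self (.of_nonneg (E_nonneg hp').2)
  rw [e, norm_smul, norm_inv, Complex.norm_natCast]
  rw [div_lt_iff₀ hε] at hn
  rw [inv_mul_le_iff₀ hn0]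
  nlinarith

/-- A tracial state vanishes on the commutator span. -/
lemma trace_N {τ : WeakDual ℂ A} (hτ : τ ∈ tracialStates A) {x : A} (hx : x ∈ N A) : τ x = 0 := by
  induction hx using Submodule.span_induction with
  | mem x hx => obtain ⟨b, rfl⟩ := hx; rw [map_sub, hτ.2.2, sub_self]
  | zero => simp
  | add x y _ _ hx hy => rw [map_add, hx, hy, add_zero]
  | smul r x _ hx => rw [map_smul, hx, smul_zero]

lemma trace_closure {τ : WeakDual ℂ A} (hτ : τ ∈ tracialStates A) {x : A}
    (hx : x ∈ closure (N A : Set A)) : τ x = 0 := by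
  have hc : IsClosed {y : A | τ y = 0} := isClosed_eq (map_continuous τ) continuous_const
  exact closure_minimal (fun y hy => trace_N hτ hy) hc hx

lemma trace_nonneg {τ : WeakDual ℂ A} (hτ : τ ∈ tracialStates A) {x : A} (hx : 0 ≤ x) :
    0 ≤ (τ x).re ∧ (τ x).im = 0 := by
  obtain ⟨s, rfl⟩ := CStarAlgebra.nonneg_iff_eq_star_mul_self.1 hx
  exact hτ.2.1 s

lemma clm_algebraMap (τ : WeakDual ℂ A) (h1 : (τ 1).im = 0) (t : ℝ) :
    (τ (algebraMap ℝ A t)).re = t * (τ 1).re ∧ (τ (algebraMap ℝ A t)).im = 0 := by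
  have : algebraMap ℝ A t = (t : ℂ) • (1 : A) := by
    rw [Algebra.algebraMap_eq_smul_one]; simp
  rw [this, map_smul]
  simp [h1]

lemma trace_algebraMap {τ : WeakDual ℂ A} (hτ : τ ∈ tracialStates A) (t : ℝ) :
    τ (algebraMap ℝ A t) = t := by
  have := clm_algebraMap τ (by simp [hτ.1]) t
  apply Complex.ext <;> simp [this, hτ.1]

lemma trace_sa {τ : WeakDual ℂ A} (hτ : τ ∈ tracialStates A) {x : A} (hx : IsSelfAdjoint x) :
    (τ x).im = 0 ∧ (τ x).re ≤ ‖x‖ := by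
  have h := trace_nonneg hτ (sub_nonneg.2 hx.le_algebraMap_norm_self)
  rw [map_sub, trace_algebraMap hτ] at h
  simp at h
  exact ⟨h.2, h.1⟩

lemma trace_star {τ : WeakDual ℂ A} (hτ : τ ∈ tracialStates A) (x : A) :
    τ (star x) = star (τ x) := by
  have h1 := (trace_sa hτ (IsSelfAdjoint.add_star_self x)).1
  have h2 := (trace_sa hτ (x := Complex.I • (x - star x)) (by
    simp only [IsSelfAdjoint, star_smul, star_sub, star_star, RCLike.star_def, Complex.conj_I,
      neg_smul, smul_sub]; abel)).1
  simp at h1 h2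
  apply Complex.ext <;> simp <;> linarith

lemma trace_re_le {τ : WeakDual ℂ A} (hτ : τ ∈ tracialStates A) (x : A) : (τ x).re ≤ ‖x‖ := by
  have h := (trace_sa hτ (IsSelfAdjoint.add_star_self x)).2
  rw [map_add, trace_star hτ] at h
  have h2 : ‖x + star x‖ ≤ ‖x‖ + ‖x‖ := (norm_add_le _ _).trans (by rw [norm_star])
  simp at h
  linarith

/-- The convex cone used in the separation argument. -/
def P (A : Type*) [CStarAlgebra A] [PartialOrder A] : Set A :=
  {b | ∃ p ∈ E A, 0 ≤ b + star b + p.1 - p.2}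

lemma P_add {x y : A} (hx : x ∈ P A) (hy : y ∈ P A) : x + y ∈ P A := by
  obtain ⟨p, hp, h1⟩ := hx
  obtain ⟨q, hq, h2⟩ := hy
  refine ⟨p + q, (E A).add_mem hp hq, ?_⟩
  have := add_nonneg h1 h2
  convert this using 1
  simp only [star_add, Prod.fst_add, Prod.snd_add]
  abel

lemma P_smul {x : A} (hx : x ∈ P A) {r : ℝ} (hr : 0 ≤ r) : r • x ∈ P A := by
  obtain ⟨p, hp, h1⟩ := hx
  refine ⟨r • p, E_smul hp hr, ?_⟩
  have := smul_nonneg hr h1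
  convert this using 1
  simp [smul_add, smul_sub]

lemma P_nonneg {x : A} (hx : 0 ≤ x) : x ∈ P A :=
  ⟨0, (E A).zero_mem, by simpa [(IsSelfAdjoint.of_nonneg hx).star_eq] using add_nonneg hx hx⟩

lemma P_skew {x : A} (hx : star x = -x) : x ∈ P A :=
  ⟨0, (E A).zero_mem, by simp [hx]⟩

lemma P_comm (z : A) : star z * z - z * star z ∈ P A :=
  ⟨(2 : ℝ) • (z * star z, star z * z), E_smul (E_swap (E_gen z)) (by norm_num), by
    apply le_of_eq
    simp only [star_sub, star_mul, star_star, Prod.smul_fst, Prod.smul_snd]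
    module⟩

lemma sep {h : A} {t : ℝ} (hs : ∀ τ ∈ tracialStates A, (τ h).re ≤ t) :
    algebraMap ℝ A t - h ∈ closure (P A) := by
  by_contra hcon
  have hconv : Convex ℝ (P A) := fun x hx y hy a b ha hb _ => P_add (P_smul hx ha) (P_smul hy hb)
  obtain ⟨f, u, hf1, hf2⟩ := RCLike.geometric_hahn_banach_point_closed (𝕜 := ℂ)
    hconv.closure isClosed_closure hcon
  simp only [RCLike.re_eq_complex_re] at hf1 hf2
  have hf0 : ∀ b ∈ P A, 0 ≤ (f b).re := by
    intro b hb
    by_contra! hneg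
    have h1 : 0 ≤ u / (f b).re ∨ 0 < u := by
      by_cases hu : 0 < u
      · exact Or.inr hu
      · exact Or.inl (div_nonneg_of_nonpos (not_lt.1 hu) hneg.le)
    rcases h1 with h1 | h1
    · have := hf2 _ (subset_closure (P_smul hb h1))
      have e : f ((u / (f b).re) • b) = (u / (f b).re) • f b := by
        rw [← Complex.coe_smul, map_smul]; simp
      rw [e, Complex.real_smul, Complex.re_ofReal_mul, div_mul_cancel₀ _ hneg.ne] at this
      exact lt_irrefl _ this
    · have := hf2 _ (subset_closure (P_nonneg (le_refl (0 : A))))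
      simp at this
      linarith
  have hu : u < 0 := by
    simpa using hf2 _ (subset_closure (P_nonneg (le_refl (0 : A))))
  have him : ∀ x : A, IsSelfAdjoint x → (f x).im = 0 := by
    intro x hx
    have h1 := hf0 (Complex.I • x) (P_skew (by simp [hx.star_eq]))
    have h2 := hf0 (-(Complex.I • x)) (P_skew (by simp [hx.star_eq]))
    simp at h1 h2
    linarith
  have hpos : ∀ z : A, 0 ≤ (f (star z * z)).re ∧ (f (star z * z)).im = 0 := fun z =>
    ⟨hf0 _ (P_nonneg (star_mul_self_nonneg z)), him _ (.star_mul_self z)⟩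
  have hgen : ∀ z : A, f (z * star z - star z * z) = 0 := by
    intro z
    have h1 := hf0 _ (P_comm z)
    have h2 := hf0 _ (P_comm (star z))
    have h3 := him (z * star z - star z * z) (by simp [IsSelfAdjoint])
    simp at h1 h2 h3
    apply Complex.ext <;> simp <;> linarith
  have hN : ∀ x ∈ N A, f x = 0 := by
    intro x hx
    induction hx using Submodule.span_induction with
    | mem x hx => obtain ⟨b, rfl⟩ := hx; exact hgen b
    | zero => simp
    | add x y _ _ hx hy => rw [map_add, hx, hy, add_zero]
    | smul r x _ hx => rw [map_smul, hx, smul_zero]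
  have htr : ∀ x y : A, f (x * y) = f (y * x) := fun x y => by
    have := hN _ (comm_mem x y)
    rwa [map_sub, sub_eq_zero] at this
  have h1im : (f 1).im = 0 := him 1 (.one A)
  have hb : ∀ r : ℝ, (f (algebraMap ℝ A r)).re = r * (f 1).re := fun r =>
    (clm_algebraMap f h1im r).1
  have h1pos : 0 < (f 1).re := by
    have h10 : 0 ≤ (f 1).re := hf0 1 (P_nonneg zero_le_one)
    refine lt_of_le_of_ne h10 fun h0 => ?_
    set m := algebraMap ℝ A t - h with hm
    have k1 : ((‖m + star m‖ : ℝ) • (1 : A) + (m + star m)) ∈ P A := by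
      apply P_nonneg
      have := (IsSelfAdjoint.add_star_self m).neg_algebraMap_norm_le_self
      rw [← Algebra.algebraMap_eq_smul_one]
      exact neg_le_iff_add_nonneg'.1 this
    have k2 : m - star m ∈ P A := P_skew (by simp)
    have k3 := hf0 _ (P_add k1 k2)
    rw [← Algebra.algebraMap_eq_smul_one] at k3
    simp only [map_add, map_sub, Complex.add_re, Complex.sub_re] at k3
    rw [hb, ← h0] at k3
    linarith
  have hne : f 1 ≠ 0 := fun h0 => by simp [h0] at h1pos
  have hf1r : f 1 = ((f 1).re : ℂ) := by apply Complex.ext <;> simp [h1im]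
  have hτ : (((f 1).re⁻¹ : ℝ) : ℂ) • f ∈ tracialStates A := by
    refine ⟨?_, fun z => ⟨?_, ?_⟩, fun x y => ?_⟩
    · change (((f 1).re⁻¹ : ℝ) : ℂ) * f 1 = 1
      rw [Complex.ofReal_inv, ← hf1r, inv_mul_cancel₀ hne]
    · change 0 ≤ ((((f 1).re⁻¹ : ℝ) : ℂ) * f (star z * z)).re
      rw [Complex.re_ofReal_mul]
      exact mul_nonneg (inv_nonneg.2 h1pos.le) (hpos z).1
    · change ((((f 1).re⁻¹ : ℝ) : ℂ) * f (star z * z)).im = 0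
      rw [Complex.im_ofReal_mul, (hpos z).2, mul_zero]
    · change (((f 1).re⁻¹ : ℝ) : ℂ) * f (x * y) = (((f 1).re⁻¹ : ℝ) : ℂ) * f (y * x)
      rw [htr]
  have hfin := hs _ hτ
  change ((((f 1).re⁻¹ : ℝ) : ℂ) * f h).re ≤ t at hfin
  rw [Complex.re_ofReal_mul, inv_mul_le_iff₀ h1pos] at hfin
  rw [map_sub, Complex.sub_re, hb] at hf1
  linarith

lemma sep' {h : A} (hh : IsSelfAdjoint h) {t : ℝ} (hs : ∀ τ ∈ tracialStates A, (τ h).re ≤ t)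
    {ε : ℝ} (hε : 0 < ε) : ∃ p ∈ E A, h + p.1 ≤ algebraMap ℝ A (t + ε) + p.2 := by
  obtain ⟨k, ⟨p, hp, hk⟩, hd⟩ := Metric.mem_closure_iff.1 (sep hs) ε hε
  refine ⟨(1 / 2 : ℝ) • p.swap, E_smul (E_swap hp) (by norm_num), ?_⟩
  set m := algebraMap ℝ A t - h - k with hm
  rw [dist_eq_norm, ← hm] at hd
  have hsm : IsSelfAdjoint (algebraMap ℝ A t) := IsSelfAdjoint.algebraMap A (.all t)
  have e : star m = algebraMap ℝ A t - h - star k := by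
    rw [hm, star_sub, star_sub, hh.star_eq, hsm.star_eq]
  have b1 : -algebraMap ℝ A (2 * ε) ≤ m + star m := by
    refine le_trans ?_ (IsSelfAdjoint.add_star_self m).neg_algebraMap_norm_le_self
    apply neg_le_neg
    apply algebraMap_mono
    have := norm_add_le m (star m)
    rw [norm_star] at this
    linarith
  have b2 := add_nonneg hk (neg_le_iff_add_nonneg'.1 b1)
  have b3 := smul_nonneg (by norm_num : (0:ℝ) ≤ 1 / 2) b2
  rw [← sub_nonneg]
  convert b3 using 1
  rw [e, hm]
  simp only [Algebra.algebraMap_eq_smul_one, Prod.smul_fst, Prod.smul_snd, Prod.fst_swap,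
    Prod.snd_swap]
  module

lemma dist_le {h : A} (hh : 0 ≤ h) {t : ℝ} (ht : 0 ≤ t)
    (hs : ∀ τ ∈ tracialStates A, (τ h).re ≤ t) {ε : ℝ} (hε : 0 < ε) :
    ∃ x ∈ N A, ‖h - x‖ ≤ t + ε := by
  obtain ⟨p, hp, hle⟩ := sep' (.of_nonneg hh) hs (half_pos hε)
  obtain ⟨x, hx, hx'⟩ := cancel hp hh (by positivity) hle (half_pos hε)
  exact ⟨x, hx, by linarith⟩

lemma vanish_sa {a : A} (ha : IsSelfAdjoint a) (hs : ∀ τ ∈ tracialStates A, τ a = 0) :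
    a ∈ closure (N A : Set A) := by
  rw [Metric.mem_closure_iff]
  intro ε hε
  obtain ⟨p, hp, hle⟩ := sep' (t := 0) ha (fun τ hτ => by simp [hs τ hτ])
    (show 0 < ε / 4 by positivity)
  rw [zero_add] at hle
  obtain ⟨x, hx, hx'⟩ := dist_le (t := ε / 4) (sub_nonneg.2 hle) (by positivity) (fun τ hτ => by
    have e : algebraMap ℝ A (ε / 4) + p.2 - (a + p.1) = algebraMap ℝ A (ε / 4) - a - (p.1 - p.2) := by
      abel
    rw [e, map_sub, map_sub, trace_N hτ (E_sub_mem hp), hs τ hτ, trace_algebraMap hτ]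
    simp) (show 0 < ε / 4 by positivity)
  refine ⟨-(p.1 - p.2) - x, (N A).sub_mem ((N A).neg_mem (E_sub_mem hp)) hx, ?_⟩
  have e : a - (-(p.1 - p.2) - x)
      = algebraMap ℝ A (ε / 4) - (algebraMap ℝ A (ε / 4) + p.2 - (a + p.1) - x) := by abel
  rw [dist_eq_norm, e]
  refine (norm_sub_le _ _).trans_lt ?_
  have : ‖algebraMap ℝ A (ε / 4)‖ ≤ ε / 4 := by
    rw [CStarAlgebra.norm_le_iff_le_algebraMap _ (by positivity)
      (by rw [Algebra.algebraMap_eq_smul_one]; exact smul_nonneg (by positivity) zero_le_one)]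
  linarith

lemma vanish {a : A} (hs : ∀ τ ∈ tracialStates A, τ a = 0) : a ∈ closure (N A : Set A) := by
  have h1 := vanish_sa (IsSelfAdjoint.add_star_self a) (fun τ hτ => by
    rw [map_add, trace_star hτ, hs τ hτ]; simp)
  have h2 := vanish_sa (a := Complex.I • (a - star a)) (by
    simp only [IsSelfAdjoint, star_smul, star_sub, star_star, RCLike.star_def, Complex.conj_I,
      neg_smul, smul_sub]; abel) (fun τ hτ => by
    rw [map_smul, map_sub, trace_star hτ, hs τ hτ]; simp)
  rw [← Submodule.topologicalClosure_coe, SetLike.mem_coe] at h1 h2 ⊢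
  have h3 := Submodule.add_mem _ (Submodule.smul_mem _ (1 / 2 : ℂ) h1)
    (Submodule.smul_mem _ (-Complex.I / 2) h2)
  convert h3 using 1
  rw [smul_smul, show -Complex.I / 2 * Complex.I = 1 / 2 by
    rw [div_mul_eq_mul_div, neg_mul, Complex.I_mul_I]; norm_num]
  module

end

lemma main {A : Type*} [CStarAlgebra A] (hT : (tracialStates A).Nonempty) (a : A) :
    ((∀ τ ∈ tracialStates A, τ a = 0) ↔ a ∈ cuntzPedersenNullset A) ∧
      sSup ((fun φ : WeakDual ℂ A => (φ (star a * a)).re) '' tracialStates A) =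
        Metric.infDist (star a * a) (cuntzPedersenNullset A) := by
  letI : PartialOrder A := CStarAlgebra.spectralOrder A
  haveI : StarOrderedRing A := CStarAlgebra.spectralOrderedRing A
  have hN : cuntzPedersenNullset A = closure (N A : Set A) := rfl
  have hne : (cuntzPedersenNullset A).Nonempty := by
    rw [hN]; exact ⟨0, subset_closure (N A).zero_mem⟩
  rw [hN] at hne ⊢
  refine ⟨⟨vanish, fun h τ hτ => trace_closure hτ h⟩, le_antisymm ?_ ?_⟩
  · apply csSup_le (hT.image _)
    rintro _ ⟨τ, hτ, rfl⟩
    rw [Metric.le_infDist hne]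
    intro y hy
    have := trace_re_le hτ (star a * a - y)
    rw [map_sub, trace_closure hτ hy, sub_zero] at this
    rwa [dist_eq_norm]
  · have hbdd : BddAbove ((fun φ : WeakDual ℂ A => (φ (star a * a)).re) '' tracialStates A) := by
      refine ⟨‖star a * a‖, ?_⟩
      rintro _ ⟨τ, hτ, rfl⟩
      exact trace_re_le hτ _
    have hle : ∀ τ ∈ tracialStates A, (τ (star a * a)).re ≤
        sSup ((fun φ : WeakDual ℂ A => (φ (star a * a)).re) '' tracialStates A) :=
      fun τ hτ => le_csSup hbdd ⟨τ, hτ, rfl⟩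
    obtain ⟨τ, hτ⟩ := hT
    have h0 := (hτ.2.1 a).1.trans (hle τ hτ)
    apply le_of_forall_pos_le_add
    intro ε hε
    obtain ⟨x, hx, hx'⟩ := dist_le (star_mul_self_nonneg a) h0 hle hε
    refine (Metric.infDist_le_dist_of_mem (subset_closure hx)).trans ?_
    rwa [dist_eq_norm]

end CPNull

/-- Cuntz–Pedersen: in a unital C*-algebra with a tracial state, all tracial states vanish
on `a` iff `a` lies in the Cuntz–Pedersen nullset `A₀`; consequently
`sup_{τ∈T(A)} τ(a*a) = dist(a*a, A₀)`. -/
theorem cuntzPedersen_vanishing_and_dist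
    {A : Type*} [NormedRing A] [StarRing A] [CStarRing A] [NormedAlgebra ℂ A]
    [CompleteSpace A] [StarModule ℂ A]
    (hT : (tracialStates A).Nonempty) (a : A) :
    ((∀ τ ∈ tracialStates A, τ a = 0) ↔ a ∈ cuntzPedersenNullset A) ∧
      sSup ((fun φ : WeakDual ℂ A => (φ (star a * a)).re) '' tracialStates A) =
        Metric.infDist (star a * a) (cuntzPedersenNullset A) := by
  letI : CStarAlgebra A := {}
  exact CPNull.main hT a
end
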